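/- arXiv:1707.05852 — 2 statements merged into one kernel-verified Lean document; each statement's English description precedes it below -/
import Mathlib

section
/- The pair (a*, b*) := (m + σ√(2/π), m − σ√(2/π)) globally minimizes the two-estimator cost J over ℝ × ℝ, and the minimal value is J(a*, b*) = σ²(1 − 2/π). -/
open MeasureTheory ProbabilityTheory

noncomputable def gE (x : ℝ) : ℝ := Real.exp (-(x^2/2))

lemma gE_cont : Continuous gE := by unfold gE; fun_prop

lemma gE_deriv (x : ℝ) : HasDerivAt (fun y => - gE y) (x * gE x) x := by
  have h : HasDerivAt (fun y : ℝ => -(y^2/2)) (-x) x := by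
    have := ((hasDerivAt_pow 2 x).div_const 2).neg
    exact this.congr_deriv (by norm_num)
  have := h.exp.neg
  exact this.congr_deriv (by unfold gE; ring)

lemma gE_int : Integrable gE := by
  have := integrable_exp_neg_mul_sq (b := 1/2) (by norm_num)
  convert this using 2 with x
  unfold gE; ring_nf

lemma gE_int1 : Integrable (fun x => x * gE x) := by
  have := integrable_mul_exp_neg_mul_sq (b := 1/2) (by norm_num)
  convert this using 3 with x
  unfold gE; ring_nf

lemma gE_top : Filter.Tendsto (fun x => - gE x) Filter.atTop (nhds 0) := by
  have h : Filter.Tendsto (fun x : ℝ => x^2/2) Filter.atTop Filter.atTop :=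
    (Filter.tendsto_pow_atTop (by norm_num)).atTop_div_const (by norm_num)
  have := (Real.tendsto_exp_neg_atTop_nhds_zero.comp h).neg
  simpa [gE, Function.comp_def] using this

lemma gE_neg (x : ℝ) : gE (-x) = gE x := by simp [gE]

lemma gE_bot : Filter.Tendsto (fun x => - gE x) Filter.atBot (nhds 0) := by
  have := gE_top.comp Filter.tendsto_neg_atBot_atTop
  simpa [Function.comp_def, gE_neg] using this

lemma gE_Ioi (c : ℝ) : ∫ x in Set.Ioi c, x * gE x = gE c := by
  rw [integral_Ioi_of_hasDerivAt_of_tendsto' (fun x _ => gE_deriv x) gE_int1.integrableOn gE_top]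
  ring

lemma gE_Iic (c : ℝ) : ∫ x in Set.Iic c, x * gE x = - gE c := by
  rw [integral_Iic_of_hasDerivAt_of_tendsto' (fun x _ => gE_deriv x) gE_int1.integrableOn gE_bot]
  ring

lemma gE_total : ∫ x, gE x = Real.sqrt (2 * Real.pi) := by
  have := integral_gaussian (1/2)
  rw [show Real.pi / (1/2) = 2 * Real.pi by ring] at this
  rw [← this]
  congr 1; ext x; unfold gE; ring_nf

lemma gE_abs (c : ℝ) : ∫ x, |x - c| * gE x = 2 * gE c + c * ∫ x in (-c)..c, gE x := by
  have hint : Integrable (fun x => (x - c) * gE x) := by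
    have := gE_int1.sub (gE_int.const_mul c)
    refine this.congr (Filter.Eventually.of_forall fun x => ?_)
    simp; ring
  have hab : Integrable (fun x => |x - c| * gE x) := by
    refine hint.abs.congr (Filter.Eventually.of_forall fun x => ?_)
    simp [abs_mul, abs_of_pos (show 0 < gE x from Real.exp_pos _)]
  rw [← intervalIntegral.integral_Iic_add_Ioi (b := c) hab.integrableOn hab.integrableOn]
  have h1 : ∫ x in Set.Iic c, |x - c| * gE x = ∫ x in Set.Iic c, (c * gE x - x * gE x) := by
    refine setIntegral_congr_fun measurableSet_Iic fun x hx => ?_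
    have : x ≤ c := hx
    simp only [abs_of_nonpos (sub_nonpos.2 this)]; ring
  have h2 : ∫ x in Set.Ioi c, |x - c| * gE x = ∫ x in Set.Ioi c, (x * gE x - c * gE x) := by
    refine setIntegral_congr_fun measurableSet_Ioi fun x hx => ?_
    have : c < x := hx
    simp only [abs_of_pos (sub_pos.2 this)]; ring
  rw [h1, h2, integral_sub (gE_int.const_mul c).integrableOn gE_int1.integrableOn,
    integral_sub gE_int1.integrableOn (gE_int.const_mul c).integrableOn, gE_Ioi, gE_Iic,
    integral_const_mul, integral_const_mul,
    ← intervalIntegral.integral_Iic_sub_Iic gE_int.integrableOn gE_int.integrableOn]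
  have h3 : ∫ x in Set.Ioi c, gE x = ∫ x in Set.Iic (-c), gE x := by
    rw [← integral_comp_neg_Ioi]; simp [gE_neg]
  rw [h3]; ring

lemma gE_disc (R : ℝ) (hR : 0 ≤ R) :
    ∫ p : ℝ × ℝ, Set.indicator {p : ℝ × ℝ | p.1^2 + p.2^2 ≤ R^2} (fun p => gE p.1 * gE p.2) p
      = 2 * Real.pi * (1 - gE R) := by
  rw [← integral_comp_polarCoord_symm]
  have h1 : ∫ p in polarCoord.target, p.1 • Set.indicator {p : ℝ × ℝ | p.1^2 + p.2^2 ≤ R^2}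
      (fun p => gE p.1 * gE p.2) (polarCoord.symm p) =
      ∫ p in (Set.Ioi (0:ℝ)) ×ˢ (Set.Ioo (-Real.pi) Real.pi),
        (Set.indicator (Set.Iic R) (fun r => r * gE r) p.1) * (1:ℝ) := by
    rw [polarCoord_target]
    refine setIntegral_congr_fun (measurableSet_Ioi.prod measurableSet_Ioo) fun p hp => ?_
    obtain ⟨hp1, hp2⟩ := hp
    have hp1 : 0 < p.1 := hp1
    have e : (p.1 * Real.cos p.2)^2 + (p.1 * Real.sin p.2)^2 = p.1^2 := by
      have := Real.sin_sq_add_cos_sq p.2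
      linear_combination p.1^2 * this
    have e2 : gE (p.1 * Real.cos p.2) * gE (p.1 * Real.sin p.2) = gE p.1 := by
      unfold gE; rw [← Real.exp_add]; congr 1; linear_combination -e/2
    simp only [polarCoord_symm_apply, Set.indicator, Set.mem_ofPred_eq, e, e2, Set.mem_Iic,
      smul_eq_mul, mul_one, pow_le_pow_iff_left₀ hp1.le hR two_ne_zero]
    split_ifs <;> simp
  rw [h1]
  rw [Measure.volume_eq_prod, setIntegral_prod_mul (f := Set.indicator (Set.Iic R) (fun r => r * gE r)) (g := fun _ => (1:ℝ))]
  rw [setIntegral_indicator measurableSet_Iic, Set.Ioi_inter_Iic, ← intervalIntegral.integral_of_le hR,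
    intervalIntegral.integral_eq_sub_of_hasDerivAt (fun x _ => gE_deriv x) gE_int1.intervalIntegrable]
  have : gE 0 = 1 := by simp [gE]
  simp [this, Real.pi_pos.le]
  ring

lemma gE_sq (c : ℝ) (hc : 0 ≤ c) : (∫ x in (-c)..c, gE x)^2 ≤ 2 * Real.pi * (1 - gE c ^ 2) := by
  have e : gE c ^ 2 = gE (Real.sqrt 2 * c) := by
    unfold gE; rw [← Real.exp_nat_mul, mul_pow, Real.sq_sqrt (by norm_num)]; congr 1; push_cast; ring
  rw [e, ← gE_disc _ (by positivity), sq, intervalIntegral.integral_of_le (by linarith),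
    ← setIntegral_prod_mul, ← Measure.volume_eq_prod, ← integral_indicator (measurableSet_Ioc.prod measurableSet_Ioc)]
  have hi : Integrable (fun p : ℝ × ℝ => gE p.1 * gE p.2) := gE_int.mul_prod gE_int
  refine integral_mono (hi.indicator (measurableSet_Ioc.prod measurableSet_Ioc))
    (hi.indicator (measurableSet_le (by fun_prop) (by fun_prop))) fun p => ?_
  refine Set.indicator_le_indicator_of_subset ?_ (fun p => by unfold gE; positivity) p
  rintro ⟨x, y⟩ ⟨⟨hx1, hx2⟩, hy1, hy2⟩
  simp only [Set.mem_ofPred_eq, mul_pow, Real.sq_sqrt (show (0:ℝ) ≤ 2 by norm_num)] at *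
  nlinarith

lemma gA_eq (c : ℝ) : ∫ x, |x - c| ∂(gaussianReal 0 1) =
    (Real.sqrt (2 * Real.pi))⁻¹ * (2 * gE c + c * ∫ x in (-c)..c, gE x) := by
  rw [integral_gaussianReal_eq_integral_smul one_ne_zero, ← gE_abs, ← integral_const_mul]
  congr 1; ext x
  simp [gaussianPDFReal, gE, neg_div]; ring

lemma gA_le (c : ℝ) : (∫ x, |x - c| ∂(gaussianReal 0 1))^2 ≤ c^2 + 2 / Real.pi := by
  have key : (∫ x in (-c)..c, gE x)^2 ≤ 2 * Real.pi * (1 - gE c ^ 2) := by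
    rcases le_total 0 c with h | h
    · exact gE_sq c h
    · have := gE_sq (-c) (by linarith)
      rw [neg_neg, intervalIntegral.integral_symm, neg_sq, gE_neg] at this
      exact this
  rw [gA_eq, mul_pow, inv_pow, Real.sq_sqrt (by positivity)]
  have hp := Real.pi_pos
  set q := ∫ x in (-c)..c, gE x
  set e := gE c
  have h : (2 * e + c * q)^2 ≤ (c^2 + 2/Real.pi) * (2 * Real.pi) := by
    have h1 : (2 * e + c * q)^2 ≤ (c^2 + 2/Real.pi) * (2 * Real.pi * e^2 + q^2) := by
      have : (c^2 + 2/Real.pi) * (2 * Real.pi * e^2 + q^2) - (2 * e + c * q)^2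
        = 2 / Real.pi * (q - c * Real.pi * e)^2 := by field_simp; ring
      have : 0 ≤ 2 / Real.pi * (q - c * Real.pi * e)^2 := by positivity
      linarith
    refine h1.trans (mul_le_mul_of_nonneg_left (by linarith) (by positivity))
  rw [inv_mul_le_iff₀ (by positivity)]
  linarith

lemma gA_zero : ∫ x, |x| ∂(gaussianReal 0 1) = Real.sqrt (2 / Real.pi) := by
  have := gA_eq 0
  simp only [sub_zero] at this
  rw [this]
  have : gE 0 = 1 := by simp [gE]
  rw [this]
  symm
  rw [Real.sqrt_eq_iff_mul_self_eq (by positivity) (by simp only [zero_mul, add_zero]; positivity)]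
  have := Real.mul_self_sqrt (show 0 ≤ 2 * Real.pi by positivity)
  have hp := Real.pi_pos
  simp only [zero_mul, add_zero]
  rw [show (Real.sqrt (2 * Real.pi))⁻¹ * (2*1) * ((Real.sqrt (2 * Real.pi))⁻¹ * (2*1)) = 4 * (Real.sqrt (2 * Real.pi) * Real.sqrt (2 * Real.pi))⁻¹ by rw [mul_inv]; ring, this]
  field_simp; norm_num

lemma gi1 : Integrable (fun x : ℝ => x) (gaussianReal 0 1) :=
  (memLp_id_gaussianReal (μ := 0) (v := 1) 1).integrable le_rfl

lemma gi2 : Integrable (fun x : ℝ => x^2) (gaussianReal 0 1) :=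
  (memLp_id_gaussianReal (μ := 0) (v := 1) 2).integrable_sq

lemma g2 : ∫ x, x^2 ∂(gaussianReal 0 1) = 1 := by
  have := variance_id_gaussianReal (μ := 0) (v := 1)
  rw [variance_eq_sub (memLp_id_gaussianReal (μ := 0) (v := 1) 2)] at this
  simpa using this

lemma min_form (c d x : ℝ) (hd : 0 ≤ d) : min ((c + d - x)^2) ((c - d - x)^2) =
    x^2 - 2 * c * x + (c^2 + d^2) - 2 * d * |x - c| := by
  rcases le_total c x with h | h
  · rw [abs_of_nonneg (by linarith), min_eq_left (by nlinarith)]; ring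
  · rw [abs_of_nonpos (by linarith), min_eq_right (by nlinarith)]; ring

lemma J_form (c d : ℝ) (hd : 0 ≤ d) :
    ∫ x, min ((c + d - x)^2) ((c - d - x)^2) ∂(gaussianReal 0 1) =
      1 + c^2 + d^2 - 2 * d * ∫ x, |x - c| ∂(gaussianReal 0 1) := by
  simp_rw [min_form c d _ hd]
  have ha : Integrable (fun x : ℝ => |x - c|) (gaussianReal 0 1) := (gi1.sub (integrable_const c)).abs
  have h0 : ∫ x, x ∂(gaussianReal 0 1) = 0 := integral_id_gaussianReal
  have i1 : Integrable (fun x : ℝ => x^2 - 2 * c * x) (gaussianReal 0 1) :=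
    gi2.sub (gi1.const_mul _)
  have i2 : Integrable (fun x : ℝ => x^2 - 2 * c * x + (c^2 + d^2)) (gaussianReal 0 1) :=
    i1.add (integrable_const _)
  rw [integral_sub i2 (ha.const_mul _), integral_add i1 (integrable_const _),
    integral_sub gi2 (gi1.const_mul _), integral_const_mul, integral_const_mul, g2, h0]
  simp; ring

lemma J_ge (a b : ℝ) : 1 - 2 / Real.pi ≤
    ∫ x, min ((a - x)^2) ((b - x)^2) ∂(gaussianReal 0 1) := by
  wlog h : b ≤ a generalizing a b
  · simp_rw [min_comm ((a - _)^2)]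
    exact this b a (by linarith)
  have := J_form ((a+b)/2) ((a-b)/2) (by linarith)
  rw [show (a+b)/2 + (a-b)/2 = a by ring, show (a+b)/2 - (a-b)/2 = b by ring] at this
  rw [this]
  have := gA_le ((a+b)/2)
  nlinarith [sq_nonneg ((a-b)/2 - ∫ x, |x - (a+b)/2| ∂(gaussianReal 0 1))]

lemma J_eq : ∫ x, min ((Real.sqrt (2 / Real.pi) - x)^2) ((- Real.sqrt (2 / Real.pi) - x)^2)
    ∂(gaussianReal 0 1) = 1 - 2 / Real.pi := by
  have := J_form 0 (Real.sqrt (2 / Real.pi)) (by positivity)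
  simp only [zero_add, zero_sub, sub_zero, gA_zero] at this
  rw [this]
  have := Real.mul_self_sqrt (show 0 ≤ 2 / Real.pi by positivity)
  linear_combination -this

lemma J_scale (m σ : ℝ) (a b : ℝ) :
    ∫ x, min ((m + σ * a - x)^2) ((m + σ * b - x)^2) ∂(gaussianReal m ⟨σ ^ 2, sq_nonneg σ⟩)
      = σ^2 * ∫ x, min ((a - x)^2) ((b - x)^2) ∂(gaussianReal 0 1) := by
  have h : gaussianReal m ⟨σ ^ 2, sq_nonneg σ⟩ = (gaussianReal 0 1).map (fun x => m + σ * x) := by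
    have h1 := gaussianReal_map_const_mul (μ := 0) (v := 1) σ
    have h2 := gaussianReal_map_const_add (μ := σ * 0) (v := .mk (σ ^ 2) (sq_nonneg σ) * 1) m
    rw [← h1, Measure.map_map (by fun_prop) (by fun_prop)] at h2
    simp only [mul_zero, mul_one, zero_add] at h2
    exact h2.symm
  rw [h, integral_map (by fun_prop) (by fun_prop), ← integral_const_mul]
  congr 1; ext x
  rw [mul_min_of_nonneg _ _ (sq_nonneg σ)]
  congr 1 <;> ring


/-- For a Gaussian measure `γ` on `ℝ` with mean `m` and variance `σ²`, the pair
`(m + σ√(2/π), m − σ√(2/π))` globally minimizes the two-estimator cost, with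
minimal value `σ²(1 − 2/π)`. -/
theorem gaussian_heterarchical_optimal_1D
    (m σ : ℝ) (hσ : 0 < σ)
    (γ : Measure ℝ) (hγ : γ = gaussianReal m ⟨σ ^ 2, sq_nonneg σ⟩) :
    (∀ a b : ℝ,
      ∫ x, min ((m + σ * Real.sqrt (2 / Real.pi) - x) ^ 2)
              ((m - σ * Real.sqrt (2 / Real.pi) - x) ^ 2) ∂γ ≤
        ∫ x, min ((a - x) ^ 2) ((b - x) ^ 2) ∂γ) ∧
    ∫ x, min ((m + σ * Real.sqrt (2 / Real.pi) - x) ^ 2)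
            ((m - σ * Real.sqrt (2 / Real.pi) - x) ^ 2) ∂γ =
      σ ^ 2 * (1 - 2 / Real.pi) := by
  subst hγ
  have e : ∫ x, min ((m + σ * Real.sqrt (2 / Real.pi) - x) ^ 2)
            ((m - σ * Real.sqrt (2 / Real.pi) - x) ^ 2) ∂(gaussianReal m ⟨σ ^ 2, sq_nonneg σ⟩) =
      σ ^ 2 * (1 - 2 / Real.pi) := by
    rw [← J_eq, ← J_scale m]
    simp only [mul_neg, ← sub_eq_add_neg]
  refine ⟨fun a b => ?_, e⟩
  rw [e]
  have := J_scale m σ ((a - m)/σ) ((b - m)/σ)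
  rw [mul_div_cancel₀ _ hσ.ne', mul_div_cancel₀ _ hσ.ne', add_sub_cancel, add_sub_cancel] at this
  rw [this]
  exact mul_le_mul_of_nonneg_left (J_ge _ _) (sq_nonneg σ)
end

section
/- The pair (a*, b*) := (μ + √(2λ₁/π) v, μ − √(2λ₁/π) v) globally minimizes the two-estimator cost J over ℝⁿ × ℝⁿ, and the minimal value is J(a*, b*) = trace(R) − (2/π)λ₁. -/
open MeasureTheory Matrix

namespace GH
open ProbabilityTheory
open scoped RealInnerProductSpace MatrixOrder


lemma std_density (n : ℕ) :
    stdGaussian (EuclideanSpace ℝ (Fin n)) = volume.withDensity (fun x =>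
      ENNReal.ofReal ((2 * Real.pi) ^ (-(n : ℝ) / 2) * Real.exp (-(1 / 2) * ‖x‖ ^ 2))) := by
  have hint : Integrable (fun x : EuclideanSpace ℝ (Fin n) =>
      (2 * Real.pi) ^ (-(n : ℝ) / 2) * Real.exp (-(1 / 2) * ‖x‖ ^ 2)) := by
    have h := (GaussianFourier.integrable_cexp_neg_mul_sq_norm_add
      (V := EuclideanSpace ℝ (Fin n)) (b := 1 / 2) (by norm_num) 0 0).norm
    refine (h.congr (ae_of_all _ fun x => ?_)).const_mul _
    simp only [Complex.norm_exp]
    congr 1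
    simp [← Complex.ofReal_pow]
  have := isFiniteMeasure_withDensity_ofReal hint.2
  apply Measure.ext_of_charFun
  ext t
  rw [charFun_stdGaussian, charFun_apply, integral_withDensity_eq_integral_toReal_smul
    (by fun_prop) (by simp)]
  have h := GaussianFourier.integral_cexp_neg_mul_sq_norm_add
      (V := EuclideanSpace ℝ (Fin n)) (b := 1 / 2) (by norm_num) Complex.I t
  have e : ∀ x : EuclideanSpace ℝ (Fin n),
     (ENNReal.ofReal ((2 * Real.pi) ^ (-(n : ℝ) / 2) * Real.exp (-(1 / 2) * ‖x‖ ^ 2))).toReal •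
      Complex.exp (⟪x, t⟫ * Complex.I) = (((2 * Real.pi) ^ (-(n : ℝ) / 2) : ℝ) : ℂ) *
        Complex.exp (-(1/2) * ‖x‖ ^ 2 + Complex.I * ⟪t, x⟫) := by
    intro x
    rw [ENNReal.toReal_ofReal (by positivity), Complex.real_smul, Complex.exp_add,
      real_inner_comm]
    push_cast
    ring_nf
  simp_rw [e]
  rw [integral_const_mul, h]
  have h2 : ((Real.pi : ℂ) / (1 / 2)) ^ ((Module.finrank ℝ (EuclideanSpace ℝ (Fin n)) : ℂ) / 2)
     = (((2 * Real.pi) ^ ((n : ℝ) / 2) : ℝ) : ℂ) := by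
    rw [Complex.ofReal_cpow (by positivity)]
    simp
    ring_nf
  rw [h2, ← mul_assoc, ← Complex.ofReal_mul, ← Real.rpow_add (by positivity),
    show -(n : ℝ) / 2 + n / 2 = 0 by ring, Real.rpow_zero]
  simp
  ring_nf

lemma gamma_eq (n : ℕ) (μv : EuclideanSpace ℝ (Fin n))
    (R : Matrix (Fin n) (Fin n) ℝ) (hR : R.PosDef) :
    volume.withDensity (fun x : EuclideanSpace ℝ (Fin n) =>
      ENNReal.ofReal ((2 * Real.pi) ^ (-(n : ℝ) / 2) * R.det ^ (-(1 : ℝ) / 2) *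
        Real.exp (-(1 / 2) *
          ((fun i => x i - μv i) ⬝ᵥ R⁻¹.mulVec (fun i => x i - μv i))))) =
    multivariateGaussian μv R := by
  set S := CFC.sqrt R with hS
  have hSS : S * S = R := CFC.sqrt_mul_sqrt_self _ hR.posSemidef.nonneg
  have hSsa : IsSelfAdjoint S := (CFC.sqrt_nonneg R).isSelfAdjoint
  have hSpsd : S.PosSemidef := by
    have := CFC.sqrt_nonneg R
    exact Matrix.nonneg_iff_posSemidef.1 this
  have hdet : S.det * S.det = R.det := by rw [← det_mul, hSS]
  have hRdet : 0 < R.det := hR.det_pos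
  have hSdet : 0 < S.det := by
    have := hSpsd.det_nonneg
    rcases this.eq_or_lt with h | h
    · rw [← h] at hdet; simp at hdet; linarith
    · exact h
  have hRd : R.det ^ (-(1 : ℝ) / 2) = S.det⁻¹ := by
    rw [← hdet, ← sq, ← Real.rpow_natCast, ← Real.rpow_mul hSdet.le, ← Real.rpow_neg_one]
    norm_num
  have hquad : ∀ y : Fin n → ℝ, (S *ᵥ y) ⬝ᵥ R⁻¹ *ᵥ (S *ᵥ y) = y ⬝ᵥ y := by
    intro y
    have hT : Sᵀ = S := by
      have := hSsa.star_eq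
      rwa [star_eq_conjTranspose, conjTranspose_eq_transpose_of_trivial] at this
    have hu : IsUnit S.det := hSdet.ne'.isUnit
    rw [← hSS, Matrix.mul_inv_rev, Matrix.mulVec_mulVec, Matrix.mul_assoc,
      Matrix.nonsing_inv_mul _ hu, Matrix.mul_one, ← Matrix.vecMul_transpose, hT,
      ← Matrix.dotProduct_mulVec, Matrix.mulVec_mulVec, Matrix.mul_nonsing_inv _ hu,
      Matrix.one_mulVec]
  set T : EuclideanSpace ℝ (Fin n) →L[ℝ] EuclideanSpace ℝ (Fin n) :=
    toEuclideanCLM (𝕜 := ℝ) S with hTdef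
  have hTdet : LinearMap.det (T : EuclideanSpace ℝ (Fin n) →ₗ[ℝ] EuclideanSpace ℝ (Fin n))
      = S.det := by
    rw [hTdef, coe_toEuclideanCLM_eq_toEuclideanLin, toEuclideanLin_eq_toLin]
    simp
  have hmap : (volume : Measure (EuclideanSpace ℝ (Fin n))).map (fun y => μv + T y) =
      ENNReal.ofReal (S.det⁻¹) • volume := by
    have h1 := Measure.map_linearMap_addHaar_eq_smul_addHaar
      (volume : Measure (EuclideanSpace ℝ (Fin n)))
      (f := (T : EuclideanSpace ℝ (Fin n) →ₗ[ℝ] EuclideanSpace ℝ (Fin n)))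
      (by rw [hTdet]; exact hSdet.ne')
    rw [hTdet, abs_of_pos (by positivity)] at h1
    have : (fun y => μv + T y) = (fun y => μv + y) ∘ T := rfl
    rw [this, ← Measure.map_map (by fun_prop) (by fun_prop)]
    have h3 : Measure.map T volume = ENNReal.ofReal (S.det⁻¹) • volume := h1
    rw [h3, Measure.map_smul]
    rw [map_add_left_eq_self]
  rw [multivariateGaussian, std_density]
  ext s hs
  have hm : Measurable (fun y => μv + T y) := by fun_prop
  have hq : Measurable (fun x : EuclideanSpace ℝ (Fin n) =>
      (fun i => x i - μv i) ⬝ᵥ R⁻¹.mulVec (fun i => x i - μv i)) := by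
    unfold dotProduct mulVec dotProduct
    fun_prop
  rw [Measure.map_apply hm hs, withDensity_apply _ (hm hs), withDensity_apply _ hs]
  have hvol : (volume : Measure (EuclideanSpace ℝ (Fin n))) =
    ENNReal.ofReal S.det • (volume : Measure (EuclideanSpace ℝ (Fin n))).map
      (fun y => μv + T y) := by
    rw [hmap, smul_smul, ← ENNReal.ofReal_mul hSdet.le, mul_inv_cancel₀ hSdet.ne']
    simp
  conv_lhs => rw [hvol]
  rw [Measure.restrict_smul, lintegral_smul_measure, setLIntegral_map hs (by fun_prop) hm,
    smul_eq_mul, ← lintegral_const_mul _ (by fun_prop)]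
  refine lintegral_congr fun y => ?_
  rw [← ENNReal.ofReal_mul hSdet.le]
  congr 1
  have e : (fun i => (μv + T y) i - μv i) = S *ᵥ (fun i => y i) := by
    funext i
    simp [hTdef]
  rw [e, hquad, hRd, EuclideanSpace.real_norm_sq_eq]
  have : (fun i => y i) ⬝ᵥ (fun i => y i) = ∑ i, y i ^ 2 := by
    simp [dotProduct, sq]
  rw [this]
  field_simp


lemma int_gauss : Integrable (fun x : ℝ => Real.exp (-x ^ 2 / 2)) := by
  have := integrable_exp_neg_mul_sq (b := 1 / 2) (by norm_num)
  refine this.congr (ae_of_all _ fun x => ?_)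
  simp only
  congr 1; ring

lemma int_abs_gauss : Integrable (fun x : ℝ => |x| * Real.exp (-x ^ 2 / 2)) := by
  have := (integrable_mul_exp_neg_mul_sq (b := 1 / 2) (by norm_num)).norm
  refine this.congr (ae_of_all _ fun x => ?_)
  simp only [norm_mul, Real.norm_eq_abs, Real.abs_exp]
  congr 2; ring

lemma hasDeriv_gauss (x : ℝ) : HasDerivAt (fun x : ℝ => - Real.exp (-x ^ 2 / 2))
    (x * Real.exp (-x ^ 2 / 2)) x := by
  have := (((hasDerivAt_pow 2 x).neg.div_const 2).exp).neg
  convert! this using 1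
  simp
  ring

lemma tail_int (u : ℝ) : ∫ x in Set.Ioi u, x * Real.exp (-x ^ 2 / 2) = Real.exp (-u ^ 2 / 2) := by
  have hi : IntegrableOn (fun x : ℝ => x * Real.exp (-x ^ 2 / 2)) (Set.Ioi u) := by
    refine Integrable.integrableOn ?_
    refine int_abs_gauss.mono (by fun_prop) (ae_of_all _ fun x => ?_)
    simp
  have ht : Filter.Tendsto (fun x : ℝ => - Real.exp (-x ^ 2 / 2)) Filter.atTop (nhds 0) := by
    rw [← neg_zero]
    refine Filter.Tendsto.neg (Real.tendsto_exp_atBot.comp ?_)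
    have : Filter.Tendsto (fun x : ℝ => x ^ 2 / 2) Filter.atTop Filter.atTop :=
      (Filter.tendsto_pow_atTop (by norm_num)).atTop_div_const (by norm_num)
    have h2 := Filter.tendsto_neg_atTop_atBot.comp this
    refine h2.congr fun x => ?_
    simp; ring
  rw [integral_Ioi_of_hasDerivAt_of_tendsto' (fun x _ => hasDeriv_gauss x) hi ht]
  simp

lemma max_int (u : ℝ) (hu : 0 ≤ u) :
    ∫ x : ℝ, max |x| u * Real.exp (-x ^ 2 / 2) =
      u * (∫ x in Set.Icc (-u) u, Real.exp (-x ^ 2 / 2)) + 2 * Real.exp (-u ^ 2 / 2) := by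
  have h1 : ∫ x : ℝ, max |x| u * Real.exp (-x ^ 2 / 2) =
     2 * ∫ x in Set.Ioi (0 : ℝ), max x u * Real.exp (-x ^ 2 / 2) := by
    rw [← integral_comp_abs (f := fun x => max x u * Real.exp (-x ^ 2 / 2))]
    simp
  have h2 : (∫ x in Set.Icc (-u) u, Real.exp (-x ^ 2 / 2)) =
      2 * ∫ x in Set.Ioc 0 u, Real.exp (-x ^ 2 / 2) := by
    rw [← integral_indicator measurableSet_Icc]
    have : ∀ x, (Set.Icc (-u) u).indicator (fun x => Real.exp (-x ^ 2 / 2)) x =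
       (Set.Iic u).indicator (fun x => Real.exp (-x ^ 2 / 2)) |x| := by
      intro x
      simp only [Set.indicator, Set.mem_Icc, Set.mem_Iic, abs_le, sq_abs]
    simp_rw [this]
    rw [integral_comp_abs (f := (Set.Iic u).indicator (fun x => Real.exp (-x ^ 2 / 2))),
      setIntegral_indicator measurableSet_Iic, Set.Ioi_inter_Iic]
  have hint : Integrable (fun x => max |x| u * Real.exp (-x ^ 2 / 2)) := by
    refine (int_abs_gauss.add (int_gauss.const_mul u)).mono (by fun_prop) (ae_of_all _ fun x => ?_)
    have := Real.exp_pos (-x ^ 2 / 2)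
    have h0 : max |x| u ≤ |x| + u := max_le (by linarith) (by linarith [abs_nonneg x])
    simp only [Pi.add_apply, Real.norm_eq_abs]
    rw [abs_of_nonneg (mul_nonneg (le_max_of_le_right hu) this.le),
      abs_of_nonneg (add_nonneg (mul_nonneg (abs_nonneg x) this.le) (mul_nonneg hu this.le)),
      ← add_mul]
    exact mul_le_mul_of_nonneg_right h0 this.le
  have h3 : ∫ x in Set.Ioi (0 : ℝ), max x u * Real.exp (-x ^ 2 / 2) =
     (∫ x in Set.Ioc 0 u, u * Real.exp (-x ^ 2 / 2)) +
       ∫ x in Set.Ioi u, x * Real.exp (-x ^ 2 / 2) := by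
    have hio : IntegrableOn (fun x => max x u * Real.exp (-x ^ 2 / 2)) (Set.Ioi (0 : ℝ)) := by
      refine hint.integrableOn.congr_fun (fun x hx => ?_) measurableSet_Ioi
      simp only [abs_of_pos (Set.mem_Ioi.1 hx)]
    rw [← Set.Ioc_union_Ioi_eq_Ioi hu, setIntegral_union (by
      rw [Set.disjoint_left]; intro x hx hx2; exact absurd hx.2 (not_le.2 hx2)) measurableSet_Ioi
      (hio.mono_set Set.Ioc_subset_Ioi_self) (hio.mono_set (Set.Ioi_subset_Ioi hu))]
    congr 1
    · refine setIntegral_congr_fun measurableSet_Ioc fun x hx => ?_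
      simp only [max_eq_right hx.2]
    · refine setIntegral_congr_fun measurableSet_Ioi fun x hx => ?_
      simp only [max_eq_left (le_of_lt (Set.mem_Ioi.1 hx))]
  rw [h1, h2, h3, tail_int, integral_const_mul]
  ring

lemma square_le_disc (u : ℝ) (hu : 0 ≤ u) :
    (∫ x in Set.Icc (-u) u, Real.exp (-x ^ 2 / 2)) ^ 2 ≤
      2 * Real.pi * (1 - Real.exp (-u ^ 2)) := by
  set D : Set (ℝ × ℝ) := {p | p.1 ^ 2 + p.2 ^ 2 ≤ 2 * u ^ 2} with hD
  have hDm : MeasurableSet D := measurableSet_le (by fun_prop) (by fun_prop)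
  have hI : Integrable (fun p : ℝ × ℝ => Real.exp (-p.1 ^ 2 / 2) * Real.exp (-p.2 ^ 2 / 2)) :=
    int_gauss.mul_prod int_gauss
  have h1 : (∫ x in Set.Icc (-u) u, Real.exp (-x ^ 2 / 2)) ^ 2 ≤
      ∫ p in D, Real.exp (-p.1 ^ 2 / 2) * Real.exp (-p.2 ^ 2 / 2) := by
    rw [sq, ← setIntegral_prod_mul]
    refine setIntegral_mono_set hI.integrableOn (ae_of_all _ fun p => by positivity) ?_
    refine (ae_of_all _ fun p hp => ?_)
    have a := abs_le.2 hp.1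
    have b := abs_le.2 hp.2
    have ap := sq_le_sq' (by linarith [abs_nonneg p.1]) a
    have bp := sq_le_sq' (by linarith [abs_nonneg p.2]) b
    rw [sq_abs] at ap bp
    change p.1 ^ 2 + p.2 ^ 2 ≤ 2 * u ^ 2
    linarith
  refine h1.trans (le_of_eq ?_)
  rw [← integral_indicator hDm, ← integral_comp_polarCoord_symm]
  set w := Real.sqrt 2 * u with hw
  have hw0 : 0 ≤ w := by positivity
  have hw2 : w ^ 2 = 2 * u ^ 2 := by rw [hw, mul_pow, Real.sq_sqrt (by norm_num)]
  have h2 : ∀ p ∈ polarCoord.target, p.1 • D.indicator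
      (fun p => Real.exp (-p.1 ^ 2 / 2) * Real.exp (-p.2 ^ 2 / 2)) (polarCoord.symm p) =
      (Set.Iic w).indicator (fun r => r * Real.exp (-r ^ 2 / 2)) p.1 * (1 : ℝ) := by
    intro p hp
    have hp1 : 0 < p.1 := hp.1
    have hcs : (p.1 * Real.cos p.2) ^ 2 + (p.1 * Real.sin p.2) ^ 2 = p.1 ^ 2 := by
      have := Real.cos_sq_add_sin_sq p.2
      linear_combination p.1 ^ 2 * this
    have hm : polarCoord.symm p ∈ D ↔ p.1 ∈ Set.Iic w := by
      simp only [hD, polarCoord_symm_apply, Set.mem_ofPred_eq, hcs, ← hw2, Set.mem_Iic]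
      exact pow_le_pow_iff_left₀ hp1.le hw0 (by norm_num)
    by_cases h : p.1 ∈ Set.Iic w
    · rw [Set.indicator_of_mem h, Set.indicator_of_mem (hm.2 h), ← Real.exp_add, smul_eq_mul,
        mul_one]
      simp only [polarCoord_symm_apply]
      congr 2
      rw [← hcs]; ring
    · rw [Set.indicator_of_notMem h, Set.indicator_of_notMem (fun hp => h (hm.1 hp))]
      simp
  rw [setIntegral_congr_fun polarCoord.open_target.measurableSet h2, polarCoord_target]
  have hv : (volume : Measure (ℝ × ℝ)) = (volume : Measure ℝ).prod volume := rfl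
  rw [hv, setIntegral_prod_mul (fun r : ℝ => (Set.Iic w).indicator
    (fun r => r * Real.exp (-r ^ 2 / 2)) r) (fun _ : ℝ => (1 : ℝ)),
    setIntegral_indicator measurableSet_Iic, Set.Ioi_inter_Iic,
    ← intervalIntegral.integral_of_le hw0,
    intervalIntegral.integral_eq_sub_of_hasDerivAt (fun x _ => hasDeriv_gauss x)
     (Continuous.intervalIntegrable (by fun_prop) _ _)]
  rw [neg_div (2 : ℝ) (w ^ 2), hw2]
  simp
  rw [max_eq_left (by positivity)]
  ring

lemma std_abs_eq (u : ℝ) : ∫ x, |x - u| ∂(gaussianReal 0 1) =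
    (Real.sqrt (2 * Real.pi))⁻¹ * ∫ x, max |x| |u| * Real.exp (-x ^ 2 / 2) := by
  have hid : Integrable (fun x : ℝ => x) (gaussianReal 0 1) :=
    (IsGaussian.integrable_id (μ := gaussianReal 0 1))
  have h1 : ∫ x, |x - u| ∂(gaussianReal 0 1) = ∫ x, |x + u| ∂(gaussianReal 0 1) := by
    have : gaussianReal 0 1 = (gaussianReal 0 1).map (fun x => -x) := by
      rw [gaussianReal_map_neg]; simp
    conv_lhs => rw [this]
    rw [integral_map (by fun_prop) (by fun_prop)]
    refine integral_congr_ae (ae_of_all _ fun x => ?_)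
    simp only
    rw [← abs_neg]; congr 1; ring
  have i1 : Integrable (fun x => |x - u|) (gaussianReal 0 1) := (hid.sub (integrable_const u)).abs
  have i2 : Integrable (fun x => |x + u|) (gaussianReal 0 1) := (hid.add (integrable_const u)).abs
  have h2 : ∫ x, |x - u| ∂(gaussianReal 0 1) = ∫ x, max |x| |u| ∂(gaussianReal 0 1) := by
    have h3 : ∫ x, 2 * max |x| |u| ∂(gaussianReal 0 1) =
        ∫ x, (|x - u| + |x + u|) ∂(gaussianReal 0 1) := by
      refine integral_congr_ae (ae_of_all _ fun x => ?_)
      simp only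
      rcases abs_cases (x - u) with h | h <;> rcases abs_cases (x + u) with hp | hp <;>
      rcases abs_cases x with k | k <;> rcases abs_cases u with kp | kp <;>
      rcases max_cases |x| |u| with l | l <;> linarith
    rw [integral_const_mul, integral_add i1 i2, ← h1] at h3
    linarith
  rw [h2, integral_gaussianReal_eq_integral_smul (by norm_num), ← integral_const_mul]
  refine integral_congr_ae (ae_of_all _ fun x => ?_)
  simp [gaussianPDFReal]
  ring

lemma std_abs_le (u : ℝ) : ∫ x, |x - u| ∂(gaussianReal 0 1) ≤
    Real.sqrt (u ^ 2 + 2 / Real.pi) := by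
  apply Real.le_sqrt_of_sq_le
  rw [std_abs_eq, max_int _ (abs_nonneg u)]
  have h := square_le_disc |u| (abs_nonneg u)
  set p := ∫ x in Set.Icc (-|u|) |u|, Real.exp (-x ^ 2 / 2)
  have he : Real.exp (-|u| ^ 2) = Real.exp (-|u| ^ 2 / 2) ^ 2 := by
    rw [← Real.exp_nat_mul]; congr 1; push_cast; ring
  rw [he] at h
  set e := Real.exp (-|u| ^ 2 / 2)
  rw [← sq_abs u]
  set w := |u|
  have hpi := Real.pi_pos
  rw [mul_pow, inv_pow, Real.sq_sqrt (by positivity), inv_mul_le_iff₀ (by positivity)]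
  have h1 : (w * p + 2 * e) ^ 2 ≤ (w ^ 2 + 2 / Real.pi) * (p ^ 2 + 2 * Real.pi * e ^ 2) := by
    have : (w ^ 2 + 2 / Real.pi) * (p ^ 2 + 2 * Real.pi * e ^ 2) - (w * p + 2 * e) ^ 2 =
      (2 / Real.pi) * (p - Real.pi * w * e) ^ 2 := by
      field_simp; ring
    have h2 : 0 ≤ (2 / Real.pi) * (p - Real.pi * w * e) ^ 2 := by positivity
    linarith
  have h3 : (w ^ 2 + 2 / Real.pi) * (p ^ 2 + 2 * Real.pi * e ^ 2) ≤
     (w ^ 2 + 2 / Real.pi) * (2 * Real.pi) :=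
    mul_le_mul_of_nonneg_left (by linarith) (by positivity)
  linarith

lemma std_abs : ∫ x, |x| ∂(gaussianReal 0 1) = Real.sqrt (2 / Real.pi) := by
  have h := std_abs_eq 0
  rw [max_int _ (abs_nonneg _)] at h
  simp only [sub_zero, abs_zero, zero_mul, zero_add] at h
  rw [show -(0 : ℝ) ^ 2 / 2 = 0 by norm_num, Real.exp_zero, mul_one] at h
  rw [h]
  have hpi := Real.pi_pos
  symm
  rw [Real.sqrt_eq_iff_mul_self_eq (by positivity) (by positivity)]
  have := Real.mul_self_sqrt (show 0 ≤ 2 * Real.pi by positivity)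
  have h2 : ∀ a : ℝ, a⁻¹ * 2 * (a⁻¹ * 2) = 4 * (a * a)⁻¹ := by
    intro a; rw [mul_inv]; ring
  rw [h2, this]
  field_simp
  norm_num

lemma gr_map (s : NNReal) : gaussianReal 0 s = (gaussianReal 0 1).map (fun x => Real.sqrt s * x) := by
  rw [gaussianReal_map_const_mul]
  congr 1
  · simp
  · ext; simp

lemma gr_abs_le (s : NNReal) (t : ℝ) : ∫ x, |x - t| ∂(gaussianReal 0 s) ≤
    Real.sqrt (t ^ 2 + 2 * s / Real.pi) := by
  rcases eq_or_ne s 0 with rfl | hs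
  · simp [gaussianReal_zero_var, Real.sqrt_sq_eq_abs]
  have hsp : 0 < Real.sqrt s := Real.sqrt_pos.2 (by positivity)
  rw [gr_map, integral_map (by fun_prop) (by fun_prop)]
  have : ∀ x, |Real.sqrt s * x - t| = Real.sqrt s * |x - t / Real.sqrt s| := by
    intro x
    rw [← abs_of_pos hsp, ← abs_mul, abs_of_pos hsp]; congr 1; field_simp
  simp_rw [this]
  rw [integral_const_mul]
  refine (mul_le_mul_of_nonneg_left (std_abs_le _) hsp.le).trans (le_of_eq ?_)
  rw [← Real.sqrt_mul (by positivity), div_pow, Real.sq_sqrt (by positivity)]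
  congr 1
  have : (s : ℝ) ≠ 0 := by positivity
  field_simp

lemma gr_abs (s : NNReal) : ∫ x, |x| ∂(gaussianReal 0 s) = Real.sqrt (2 * s / Real.pi) := by
  rw [gr_map, integral_map (by fun_prop) (by fun_prop)]
  simp_rw [abs_mul, abs_of_nonneg (Real.sqrt_nonneg _)]
  rw [integral_const_mul, std_abs, ← Real.sqrt_mul (by positivity)]
  congr 1; ring


lemma min_pt {E : Type*} [NormedAddCommGroup E] [InnerProductSpace ℝ E] (m c d x : E) :
    min (‖(m + (c + d)) - x‖ ^ 2) (‖(m + (c - d)) - x‖ ^ 2) =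
      ‖x - m‖ ^ 2 + (‖c‖ ^ 2 + ‖d‖ ^ 2) - 2 * ⟪c, x - m⟫ - 2 * |⟪d, x - m⟫ - ⟪c, d⟫| := by
  have e1 : ‖(m + (c + d)) - x‖ ^ 2 = ‖x - m‖ ^ 2 + (‖c‖ ^ 2 + ‖d‖ ^ 2) - 2 * ⟪c, x - m⟫
      - 2 * (⟪d, x - m⟫ - ⟪c, d⟫) := by
    have : (m + (c + d)) - x = (c + d) - (x - m) := by abel
    rw [this, norm_sub_sq_real, norm_add_sq_real, inner_add_left]; ring
  have e2 : ‖(m + (c - d)) - x‖ ^ 2 = ‖x - m‖ ^ 2 + (‖c‖ ^ 2 + ‖d‖ ^ 2) - 2 * ⟪c, x - m⟫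
      + 2 * (⟪d, x - m⟫ - ⟪c, d⟫) := by
    have : (m + (c - d)) - x = (c - d) - (x - m) := by abel
    rw [this, norm_sub_sq_real, norm_sub_sq_real, inner_sub_left]; ring
  rw [e1, e2]
  rcases abs_cases (⟪d, x - m⟫ - ⟪c, d⟫) with h | h
  · rw [h.1, min_eq_left]; linarith
  · rw [h.1, min_eq_right] <;> linarith

lemma cost_eq (n : ℕ) (μv : EuclideanSpace ℝ (Fin n))
    (R : Matrix (Fin n) (Fin n) ℝ) (hR : R.PosDef) (c d : EuclideanSpace ℝ (Fin n)) :
    ∫ x, min (‖(μv + (c + d)) - x‖ ^ 2) (‖(μv + (c - d)) - x‖ ^ 2) ∂(multivariateGaussian μv R) =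
      R.trace + (‖c‖ ^ 2 + ‖d‖ ^ 2) -
        2 * ∫ z, |z - ⟪c, d⟫| ∂(gaussianReal 0 ((fun i => d i) ⬝ᵥ R *ᵥ (fun i => d i)).toNNReal) := by
  have hps := hR.posSemidef
  set γ := multivariateGaussian μv R with hγ
  have hid : Integrable (fun x : EuclideanSpace ℝ (Fin n) => x) γ := IsGaussian.integrable_fun_id
  have hsub : Integrable (fun x : EuclideanSpace ℝ (Fin n) => x - μv) γ :=
    hid.sub (integrable_const _)
  have hL2 : MemLp (fun x : EuclideanSpace ℝ (Fin n) => x - μv) 2 γ :=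
    (IsGaussian.memLp_two_id (μ := γ)).sub (memLp_const _)
  have i1 : Integrable (fun x : EuclideanSpace ℝ (Fin n) => ‖x - μv‖ ^ 2) γ :=
    hL2.integrable_norm_pow (by norm_num)
  have i2 : ∀ e : EuclideanSpace ℝ (Fin n), Integrable (fun x => ⟪e, x - μv⟫) γ := fun e =>
    hsub.const_inner e
  have hmean : ∀ e : EuclideanSpace ℝ (Fin n), ∫ x, ⟪e, x - μv⟫ ∂γ = 0 := by
    intro e
    rw [integral_inner hsub, integral_sub hid (integrable_const _),
      integral_id_multivariateGaussian]
    simp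
  have htr : ∫ x, ‖x - μv‖ ^ 2 ∂γ = R.trace := by
    simp_rw [EuclideanSpace.real_norm_sq_eq]
    rw [integral_finsetSum]
    · unfold Matrix.trace
      refine Finset.sum_congr rfl fun i _ => ?_
      have h1 := variance_eval_multivariateGaussian (μ := μv) hps i
      have h2 := (EuclideanSpace.proj (𝕜 := ℝ) i).integral_comp_comm hid
      rw [integral_id_multivariateGaussian] at h2
      rw [variance_eq_integral (by fun_prop)] at h1
      replace h2 : ∫ x : EuclideanSpace ℝ (Fin n), x i ∂γ = μv i := h2
      rw [h2] at h1
      simpa using h1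
    · intro i _
      refine i1.mono (by fun_prop) (ae_of_all _ fun x => ?_)
      rw [EuclideanSpace.real_norm_sq_eq]
      rw [Real.norm_of_nonneg (by positivity), Real.norm_of_nonneg (by positivity)]
      exact Finset.single_le_sum (f := fun j => (x - μv) j ^ 2) (fun j _ => sq_nonneg _)
        (Finset.mem_univ i)
  have hlaw : γ.map (fun x => ⟪d, x - μv⟫) =
      gaussianReal 0 ((fun i => d i) ⬝ᵥ R *ᵥ (fun i => d i)).toNNReal := by
    have h1 := IsGaussian.map_eq_gaussianReal (μ := γ) (innerSL ℝ d)
    have h2 : Var[(innerSL ℝ d : EuclideanSpace ℝ (Fin n) → ℝ); γ] =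
        (fun i => d i) ⬝ᵥ R *ᵥ (fun i => d i) := by
      have := covarianceBilin_multivariateGaussian (μ := μv) hps d d
      rw [covarianceBilin_self IsGaussian.memLp_two_id] at this
      exact this
    have h3 : ∫ x, (innerSL ℝ d) x ∂γ = ⟪d, μv⟫ := by
      rw [(innerSL ℝ d).integral_comp_comm hid, integral_id_multivariateGaussian]
      rfl
    rw [h2, h3] at h1
    have h4 : (fun x => ⟪d, x - μv⟫) = (fun z => z - ⟪d, μv⟫) ∘ (innerSL ℝ d) := by
      funext x; simp [inner_sub_right]
    rw [h4, ← Measure.map_map (by fun_prop) (by fun_prop), h1, gaussianReal_map_sub_const]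
    simp
  rw [← hlaw, integral_map (by fun_prop) (by fun_prop)]
  simp_rw [min_pt]
  have i3 : Integrable (fun x => 2 * |⟪d, x - μv⟫ - ⟪c, d⟫|) γ :=
    (((i2 d).sub (integrable_const _)).abs).const_mul 2
  have i4 : Integrable (fun x => ‖x - μv‖ ^ 2 + (‖c‖ ^ 2 + ‖d‖ ^ 2)) γ :=
    i1.add (integrable_const _)
  have i5 : Integrable (fun x => ‖x - μv‖ ^ 2 + (‖c‖ ^ 2 + ‖d‖ ^ 2) - 2 * ⟪c, x - μv⟫) γ :=
    i4.sub ((i2 c).const_mul 2)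
  rw [integral_sub i5 i3, integral_sub i4 ((i2 c).const_mul 2),
    integral_add i1 (integrable_const _), integral_const_mul, integral_const_mul, hmean, htr]
  simp

end GH



/-- **Optimal heterarchical estimators in the multivariate Gaussian case.**
For a Gaussian measure `γ` on `ℝⁿ` with mean `μv` and positive definite
covariance `R`, with largest eigenvalue `λ₁` and corresponding unit eigenvector
`v`, the pair `(μv + √(2λ₁/π) v, μv − √(2λ₁/π) v)` globally minimizes the
two-estimator cost, with minimal value `trace R − (2/π)λ₁`. -/
theorem gaussian_heterarchical_optimal
    (n : ℕ) (hn : 1 ≤ n)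
    (μv : EuclideanSpace ℝ (Fin n))
    (R : Matrix (Fin n) (Fin n) ℝ) (hR : R.PosDef)
    (lam1 : ℝ) (v : EuclideanSpace ℝ (Fin n)) (hv : ‖v‖ = 1)
    (heig : R.mulVec (fun i => v i) = fun i => lam1 * v i)
    (hmax : ∀ x : Fin n → ℝ, x ⬝ᵥ R.mulVec x ≤ lam1 * (x ⬝ᵥ x))
    (γ : Measure (EuclideanSpace ℝ (Fin n)))
    (hγ : γ = volume.withDensity (fun x =>
      ENNReal.ofReal ((2 * Real.pi) ^ (-(n : ℝ) / 2) * R.det ^ (-(1 : ℝ) / 2) *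
        Real.exp (-(1 / 2) *
          ((fun i => x i - μv i) ⬝ᵥ R⁻¹.mulVec (fun i => x i - μv i)))))) :
    (∀ a b : EuclideanSpace ℝ (Fin n),
      ∫ x, min (‖(μv + Real.sqrt (2 * lam1 / Real.pi) • v) - x‖ ^ 2)
              (‖(μv - Real.sqrt (2 * lam1 / Real.pi) • v) - x‖ ^ 2) ∂γ ≤
        ∫ x, min (‖a - x‖ ^ 2) (‖b - x‖ ^ 2) ∂γ) ∧
    ∫ x, min (‖(μv + Real.sqrt (2 * lam1 / Real.pi) • v) - x‖ ^ 2)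
            (‖(μv - Real.sqrt (2 * lam1 / Real.pi) • v) - x‖ ^ 2) ∂γ =
      R.trace - (2 / Real.pi) * lam1 := by
  subst hγ
  rw [GH.gamma_eq n μv R hR]
  have hpi := Real.pi_pos
  have hvv : (fun i => v i) ⬝ᵥ (fun i => v i) = 1 := by
    have h := EuclideanSpace.real_norm_sq_eq v
    rw [hv] at h
    simp only [dotProduct, ← sq]
    linarith
  have hlam : 0 ≤ lam1 := by
    have h := hR.posSemidef.dotProduct_mulVec_nonneg (fun i => v i)
    have e : star (fun i => v i) = fun i => v i := by funext i; simp
    have e2 : (fun i => lam1 * v i) = lam1 • (fun i => v i) := rfl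
    rwa [e, heig, e2, dotProduct_smul, hvv, smul_eq_mul, mul_one] at h
  set k := 2 * lam1 / Real.pi with hk
  have hk0 : 0 ≤ k := by positivity
  have hval : ∫ x, min (‖(μv + Real.sqrt k • v) - x‖ ^ 2)
            (‖(μv - Real.sqrt k • v) - x‖ ^ 2) ∂(ProbabilityTheory.multivariateGaussian μv R) =
      R.trace - (2 / Real.pi) * lam1 := by
    have h := GH.cost_eq n μv R hR 0 (Real.sqrt k • v)
    rw [zero_add, zero_sub, ← sub_eq_add_neg] at h
    rw [h]
    have e3 : (fun i => (Real.sqrt k • v) i) = Real.sqrt k • (fun i => v i) := rfl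
    have e2 : (fun i => lam1 * v i) = lam1 • (fun i => v i) := rfl
    rw [e3, mulVec_smul, heig, e2, dotProduct_smul, dotProduct_smul, smul_dotProduct, hvv]
    simp only [inner_zero_left, sub_zero, smul_eq_mul, mul_one]
    rw [GH.gr_abs, norm_smul, hv, Real.norm_of_nonneg (Real.sqrt_nonneg _), mul_one, norm_zero,
      Real.sq_sqrt hk0]
    have e4 : Real.sqrt k * (lam1 * Real.sqrt k) = lam1 * k := by
      have := Real.mul_self_sqrt hk0
      linear_combination lam1 * this
    rw [e4, Real.coe_toNNReal _ (by positivity)]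
    have e5 : 2 * (lam1 * k) / Real.pi = k ^ 2 := by rw [hk]; ring
    rw [e5, Real.sqrt_sq hk0, hk]
    ring
  refine ⟨fun a b => ?_, hval⟩
  rw [hval]
  set c := (1 / 2 : ℝ) • (a + b) - μv with hc
  set d := (1 / 2 : ℝ) • (a - b) with hd
  have ha : a = μv + (c + d) := by rw [hc, hd]; module
  have hb : b = μv + (c - d) := by rw [hc, hd]; module
  rw [ha, hb, GH.cost_eq n μv R hR c d]
  set s := (fun i => d i) ⬝ᵥ R *ᵥ (fun i => d i) with hs
  have hs0 : 0 ≤ s := by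
    have h := hR.posSemidef.dotProduct_mulVec_nonneg (fun i => d i)
    have e : star (fun i => d i) = fun i => d i := by funext i; simp
    rwa [e] at h
  have hs1 : s ≤ lam1 * ‖d‖ ^ 2 := by
    have h := hmax (fun i => d i)
    rw [EuclideanSpace.real_norm_sq_eq]
    have e : (fun i => d i) ⬝ᵥ (fun i => d i) = ∑ i, d i ^ 2 := by
      simp only [dotProduct, ← sq]
    rw [e] at h
    exact h
  have h1 := GH.gr_abs_le s.toNNReal (inner ℝ c d)
  rw [Real.coe_toNNReal _ hs0] at h1
  have h2 : Real.sqrt ((inner ℝ c d) ^ 2 + 2 * s / Real.pi) ≤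
      ‖d‖ * Real.sqrt (‖c‖ ^ 2 + k) := by
    rw [← Real.sqrt_sq (norm_nonneg d), ← Real.sqrt_mul (by positivity)]
    apply Real.sqrt_le_sqrt
    have h3 : (inner ℝ c d) ^ 2 ≤ ‖d‖ ^ 2 * ‖c‖ ^ 2 := by
      have := abs_real_inner_le_norm c d
      have h4 := pow_le_pow_left₀ (abs_nonneg _) this 2
      rw [sq_abs] at h4
      linarith [h4, mul_pow ‖c‖ ‖d‖ 2]
    have h5 : 2 * s / Real.pi ≤ ‖d‖ ^ 2 * k := by
      rw [hk, div_le_iff₀ hpi]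
      have : ‖d‖ ^ 2 * (2 * lam1 / Real.pi) * Real.pi = 2 * (lam1 * ‖d‖ ^ 2) := by field_simp
      linarith
    linarith
  have h6 := Real.sq_sqrt (show 0 ≤ ‖c‖ ^ 2 + k by positivity)
  have h7 := sq_nonneg (‖d‖ - Real.sqrt (‖c‖ ^ 2 + k))
  have h8 : 2 / Real.pi * lam1 = k := by rw [hk]; ring
  rw [h8]
  nlinarith
end
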